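/- arXiv:2112.06112 — 2 statements merged into one kernel-verified Lean document; each statement's English description precedes it below -/
import Mathlib

section
/- Let G₁ and G₂ be simple graphs on n vertices whose adjacency matrices A(G₁) and A(G₂) have the same characteristic polynomial, and suppose λ is an integer that is a simple eigenvalue of A(G₁) (and hence of A(G₂)). Let ξ ∈ ℤⁿ be an eigenvector of A(G₁) for λ and η ∈ ℤⁿ an eigenvector of A(G₂) for λ. If the ratio of Euclidean norms ‖η‖/‖ξ‖ is irrational, then there exists no orthogonal matrix Q with all rational entries such that A(G₁) = Qᵀ A(G₂) Q. -/
open Matrix Polynomial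

/-- The adjacency matrix over `ℝ` of a simple graph on `Fin n`. -/
noncomputable def adjMat {n : ℕ} (G : SimpleGraph (Fin n)) : Matrix (Fin n) (Fin n) ℝ :=
  letI : DecidableRel G.Adj := Classical.decRel G.Adj
  G.adjMatrix ℝ

/-- The chromatic index of a simple graph: the chromatic number of its line graph. -/
noncomputable def chromaticIndex {V : Type*} (G : SimpleGraph V) : ℕ∞ :=
  G.lineGraph.chromaticNumber

/-- Two vectors satisfying the eigenvector equation of a simple eigenvalue are proportional. -/
theorem Matrix.exists_smul_eq_of_rootMultiplicity_charpoly_le_one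
    {K ι : Type*} [Field K] [Fintype ι] [DecidableEq ι] (A : Matrix ι ι K) (μ : K)
    (h : A.charpoly.rootMultiplicity μ ≤ 1) {v w : ι → K} (hv0 : v ≠ 0)
    (hv : A *ᵥ v = μ • v) (hw : A *ᵥ w = μ • w) : ∃ c : K, c • v = w := by
  have hrank : Module.finrank K (Module.End.eigenspace A.toLin' μ) ≤ 1 := by
    refine (LinearMap.finrank_eigenspace_le A.toLin' μ).trans ?_
    rwa [Matrix.charpoly_toLin']
  have hvmem : v ∈ Module.End.eigenspace A.toLin' μ := by
    rwa [Module.End.mem_eigenspace_iff, Matrix.toLin'_apply]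
  have hwmem : w ∈ Module.End.eigenspace A.toLin' μ := by
    rwa [Module.End.mem_eigenspace_iff, Matrix.toLin'_apply]
  obtain ⟨u, hu⟩ := finrank_le_one_iff.mp hrank
  obtain ⟨a, ha⟩ := hu ⟨v, hvmem⟩
  obtain ⟨b, hb⟩ := hu ⟨w, hwmem⟩
  replace ha : a • (u : ι → K) = v := congrArg Subtype.val ha
  replace hb : b • (u : ι → K) = w := congrArg Subtype.val hb
  have ha0 : a ≠ 0 := by
    rintro rfl
    exact hv0 (by rw [← ha, zero_smul])
  exact ⟨b / a, by rw [← ha, ← hb, smul_smul, div_mul_cancel₀ b ha0]⟩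

/-- A matrix with orthonormal columns preserves the dot square of a vector. -/
theorem Matrix.dotProduct_mulVec_self_of_transpose_mul_self_eq_one
    {R m n : Type*} [CommRing R] [Fintype m] [Fintype n] [DecidableEq n]
    (Q : Matrix m n R) (hQ : Qᵀ * Q = 1) (x : n → R) :
    (Q *ᵥ x) ⬝ᵥ (Q *ᵥ x) = x ⬝ᵥ x := by
  rw [Matrix.dotProduct_mulVec, ← Matrix.mulVec_transpose, Matrix.mulVec_mulVec, hQ,
    Matrix.one_mulVec]

/-- **Lemma 1.** If `G₁` and `G₂` are cospectral graphs with a common simple integral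
eigenvalue `lam`, with integral eigenvectors `ξ` and `η` respectively, and the ratio
of Euclidean norms `‖η‖ / ‖ξ‖` is irrational, then there is no rational orthogonal
matrix `Q` with `A(G₁) = Qᵀ A(G₂) Q`. -/
theorem no_rational_orthogonal_similarity_of_irrational_norm_ratio
    {n : ℕ} (G₁ G₂ : SimpleGraph (Fin n))
    (hcospec : (adjMat G₁).charpoly = (adjMat G₂).charpoly)
    (lam : ℤ)
    (hsimple : ((adjMat G₁).charpoly).rootMultiplicity (lam : ℝ) = 1)
    (ξ : Fin n → ℤ) (hξ0 : ξ ≠ 0)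
    (hξ : (adjMat G₁).mulVec (fun i => (ξ i : ℝ)) = (lam : ℝ) • fun i => (ξ i : ℝ))
    (η : Fin n → ℤ) (hη0 : η ≠ 0)
    (hη : (adjMat G₂).mulVec (fun i => (η i : ℝ)) = (lam : ℝ) • fun i => (η i : ℝ))
    (hirr : Irrational
      (Real.sqrt (∑ i, (η i : ℝ) ^ 2) / Real.sqrt (∑ i, (ξ i : ℝ) ^ 2))) :
    ¬ ∃ Q : Matrix (Fin n) (Fin n) ℝ,
        Qᵀ * Q = 1 ∧ (∀ i j, ∃ q : ℚ, Q i j = (q : ℝ)) ∧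
        adjMat G₁ = Qᵀ * adjMat G₂ * Q := by
  rintro ⟨Q, hQ, hrat, hsim⟩
  set x : Fin n → ℝ := fun i => (ξ i : ℝ) with hx
  set y : Fin n → ℝ := fun i => (η i : ℝ) with hy
  obtain ⟨i, hi⟩ := Function.ne_iff.mp hη0
  have hyi : y i ≠ 0 := Int.cast_ne_zero.mpr hi
  have hy0 : y ≠ 0 := fun h => hyi (congrFun h i)
  have hQx : adjMat G₂ *ᵥ (Q *ᵥ x) = (lam : ℝ) • (Q *ᵥ x) := by
    have hcomm : adjMat G₂ * Q = Q * adjMat G₁ := by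
      rw [hsim, ← Matrix.mul_assoc, ← Matrix.mul_assoc, mul_eq_one_comm.mp hQ, Matrix.one_mul]
    rw [Matrix.mulVec_mulVec, hcomm, ← Matrix.mulVec_mulVec, hξ, Matrix.mulVec_smul]
  obtain ⟨c, hc⟩ := Matrix.exists_smul_eq_of_rootMultiplicity_charpoly_le_one (adjMat G₂)
    (lam : ℝ) (hcospec ▸ hsimple.le) hy0 hη hQx
  have hcrat : ∃ q : ℚ, (q : ℝ) = c := by
    choose q hq using hrat
    refine ⟨(∑ j, q i j * ξ j) / η i, ?_⟩
    have hci : c * y i = ∑ j, Q i j * x j := congrFun hc i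
    push_cast
    rw [div_eq_iff hyi, hci]
    exact Finset.sum_congr rfl fun j _ => by rw [hq i j]
  obtain ⟨q, rfl⟩ := hcrat
  have hnorm : ∑ j, (ξ j : ℝ) ^ 2 = (q : ℝ) ^ 2 * ∑ j, (η j : ℝ) ^ 2 := by
    have h := Matrix.dotProduct_mulVec_self_of_transpose_mul_self_eq_one Q hQ x
    rw [← hc] at h
    simp only [dotProduct, Pi.smul_apply, smul_eq_mul] at h
    simp only [Finset.mul_sum]
    rw [Finset.sum_congr rfl fun j _ => pow_two (ξ j : ℝ), ← h]
    exact Finset.sum_congr rfl fun j _ => by ring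
  have hpos : 0 < ∑ j, (η j : ℝ) ^ 2 :=
    Finset.sum_pos' (fun j _ => sq_nonneg _) ⟨i, Finset.mem_univ i, sq_pos_of_ne_zero hyi⟩
  refine hirr ⟨|q|⁻¹, ?_⟩
  rw [hnorm, Real.sqrt_mul (sq_nonneg _), Real.sqrt_sq_eq_abs,
    div_mul_cancel_right₀ (Real.sqrt_pos.mpr hpos).ne']
  push_cast
  rfl
end

section
/- There exist two 3-regular simple graphs G and H on 16 vertices that are cospectral (their adjacency matrices have the same characteristic polynomial), are not isomorphic, and have different chromatic indexes: the chromatic index of G is 3 while the chromatic index of H is 4. -/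
open Matrix Polynomial

namespace SimpleGraph

variable {V : Type*} {G : SimpleGraph V} {k : ℕ}

theorem lineGraph_colorable_iff [NeZero k] :
    G.lineGraph.Colorable k ↔ ∃ c : Sym2 V → Fin k,
      ∀ v a b, G.Adj v a → G.Adj v b → a ≠ b → c s(v, a) ≠ c s(v, b) := by
  classical
  constructor
  · rintro ⟨C⟩
    refine ⟨fun e => if h : e ∈ G.edgeSet then C ⟨e, h⟩ else 0, fun v a b ha hb hab => ?_⟩
    beta_reduce
    rw [dif_pos (G.mem_edgeSet.2 ha), dif_pos (G.mem_edgeSet.2 hb)]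
    refine C.valid (lineGraph_adj_iff_exists.2 ⟨fun h => hab ?_, v, by simp, by simp⟩)
    exact Sym2.congr_right.1 (congrArg Subtype.val h)
  · rintro ⟨c, hc⟩
    refine ⟨Coloring.mk (fun e => c e) ?_⟩
    rintro ⟨e, he⟩ ⟨f, hf⟩ hef
    obtain ⟨hne, v, hve, hvf⟩ := lineGraph_adj_iff_exists.1 hef
    obtain ⟨a, rfl⟩ := Sym2.mem_iff_exists.1 hve
    obtain ⟨b, rfl⟩ := Sym2.mem_iff_exists.1 hvf
    exact hc v a b he hf fun h => hne (by simp [h])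

/-- Two pairs are incident if they are distinct and share an endpoint. -/
def pairsIncident [DecidableEq V] (e f : V × V) : Bool :=
  e.1 == f.1 && e.2 != f.2 || e.1 == f.2 && e.2 != f.1 ||
    e.2 == f.1 && e.1 != f.2 || e.2 == f.2 && e.1 != f.1

/-- Backtracking search for an extension of the partial edge coloring `acc` to the pairs in a
list. -/
def edgeColoringExtends [DecidableEq V] (k : ℕ) : List (V × V) → List ((V × V) × Fin k) → Bool
  | [], _ => true
  | e :: es, acc => (List.finRange k).any fun c =>
      (acc.all fun p => !(pairsIncident e p.1 && c == p.2)) &&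
        edgeColoringExtends k es ((e, c) :: acc)

theorem edgeColoringExtends_eq_true [DecidableEq V] {c : V × V → Fin k} {l : List (V × V)}
    (acc : List (V × V))
    (hc : ∀ e ∈ acc ++ l, ∀ f ∈ acc ++ l, pairsIncident e f → c e ≠ c f) :
    edgeColoringExtends k l (acc.map fun e => (e, c e)) = true := by
  induction l generalizing acc with
  | nil => rfl
  | cons e es ih =>
    rw [edgeColoringExtends, List.any_eq_true]
    refine ⟨c e, List.mem_finRange _, ?_⟩
    rw [Bool.and_eq_true]
    constructor
    · simp only [List.all_map, List.all_eq_true, Function.comp]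
      intro f hf
      have := hc e (by simp) f (by simp [hf])
      simpa [← Bool.not_eq_true, or_iff_not_imp_left] using this
    · refine ih (e :: acc) fun f hf g hg => hc f ?_ g ?_
      · simp only [List.cons_append, List.mem_cons, List.mem_append] at hf ⊢; tauto
      · simp only [List.cons_append, List.mem_cons, List.mem_append] at hg ⊢; tauto

theorem not_lineGraph_colorable [DecidableEq V] [NeZero k] {l : List (V × V)}
    (hl : ∀ e ∈ l, G.Adj e.1 e.2) (h : edgeColoringExtends k l [] = false) :
    ¬ G.lineGraph.Colorable k := by
  rw [lineGraph_colorable_iff]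
  rintro ⟨c, hc⟩
  refine Bool.false_ne_true (h.symm.trans
    (edgeColoringExtends_eq_true (c := fun e => c s(e.1, e.2)) [] ?_))
  rintro ⟨a, b⟩ he ⟨a', b'⟩ hf hef
  have hab : G.Adj a b := hl _ he
  have hab' : G.Adj a' b' := hl _ hf
  simp only [pairsIncident, Bool.or_eq_true, Bool.and_eq_true, beq_iff_eq, bne_iff_ne] at hef
  rcases hef with ((⟨rfl, h⟩ | ⟨rfl, h⟩) | ⟨rfl, h⟩) | ⟨rfl, h⟩
  · exact hc _ _ _ hab hab' h
  · simpa [Sym2.eq_swap] using hc _ _ _ hab hab'.symm h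
  · simpa [Sym2.eq_swap] using hc _ _ _ hab.symm hab' h
  · simpa [Sym2.eq_swap] using hc _ _ _ hab.symm hab'.symm h

/-- The graph whose edges are the pairs occurring in a list of colored pairs. -/
def ofColoredEdges (l : List ((V × V) × Fin k)) : SimpleGraph V :=
  fromRel fun a b => (a, b) ∈ l.map Prod.fst

instance [DecidableEq V] (l : List ((V × V) × Fin k)) : DecidableRel (ofColoredEdges l).Adj :=
  inferInstanceAs (DecidableRel (fromRel fun a b => (a, b) ∈ l.map Prod.fst).Adj)

/-- The color of a pair, in either orientation, in a list of colored pairs. -/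
def listedColor [DecidableEq V] [NeZero k] (l : List ((V × V) × Fin k)) (a b : V) : Fin k :=
  ((l.lookup (a, b)).or (l.lookup (b, a))).getD 0

end SimpleGraph

namespace Matrix

theorem charpoly_eq_of_mul_eq_mul {n R : Type*} [Fintype n] [DecidableEq n] [CommRing R]
    {A B P : Matrix n n R} (hP : IsUnit P) (h : A * P = P * B) : A.charpoly = B.charpoly := by
  obtain ⟨u, rfl⟩ := hP
  rw [← charpoly_units_conj u B, ← h, mul_assoc, ← coe_units_inv, Units.mul_inv, mul_one]

theorem det_ne_zero_of_map_mul_eq_one {n R S : Type*} [Fintype n] [DecidableEq n] [CommRing R]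
    [CommRing S] [Nontrivial S] (f : R →+* S) {P : Matrix n n R} {Q : Matrix n n S}
    (h : Q * P.map f = 1) : P.det ≠ 0 := by
  intro h0
  have := congrArg det h
  rw [det_mul, ← RingHom.mapMatrix_apply, ← RingHom.map_det, h0] at this
  simp at this

end Matrix

open SimpleGraph

theorem adjMat_eq_map {n : ℕ} (G : SimpleGraph (Fin n)) [DecidableRel G.Adj] :
    adjMat G = (G.adjMatrix ℤ).map (Int.castRingHom ℝ) := by
  ext i j
  by_cases h : G.Adj i j <;> simp [adjMat, adjMatrix_apply, h]

theorem chromaticIndex_congr {V W : Type*} {G : SimpleGraph V} {H : SimpleGraph W} (f : G ≃g H) :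
    chromaticIndex G = chromaticIndex H :=
  chromaticNumber_congr f.lineGraph

/-- Edges of a cubic graph with a proper edge coloring in three colors. -/
def classOneEdges : List ((Fin 16 × Fin 16) × Fin 3) :=
  [((0, 4), 0), ((0, 14), 1), ((0, 15), 2), ((4, 14), 2), ((4, 6), 1), ((13, 14), 0),
   ((1, 13), 1), ((5, 13), 2), ((1, 15), 0), ((1, 10), 2), ((12, 15), 1), ((2, 6), 0),
   ((6, 8), 2), ((2, 10), 1), ((2, 3), 2), ((3, 10), 0), ((3, 11), 1), ((5, 11), 0),
   ((11, 12), 2), ((5, 9), 1), ((7, 12), 0), ((7, 8), 1), ((7, 9), 2), ((8, 9), 0)]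

/-- Edges of a cubic graph with a proper edge coloring in four colors. -/
def classTwoEdges : List ((Fin 16 × Fin 16) × Fin 4) :=
  [((0, 1), 0), ((0, 5), 1), ((0, 10), 2), ((5, 10), 0), ((5, 9), 2), ((10, 14), 1),
   ((1, 2), 1), ((1, 15), 2), ((2, 7), 0), ((2, 12), 2), ((9, 12), 0), ((3, 12), 1),
   ((6, 9), 1), ((3, 15), 0), ((6, 15), 3), ((3, 4), 2), ((6, 8), 0), ((4, 14), 0),
   ((4, 13), 1), ((13, 14), 2), ((11, 13), 0), ((7, 8), 1), ((7, 11), 2), ((8, 11), 3)]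

/-- An integer matrix intertwining the two adjacency matrices. -/
def intertwiner : Matrix (Fin 16) (Fin 16) ℤ :=
  !![1, 0, -1, 0, 0, 1, -1, -1, -1, 1, 1, -1, 0, 0, 0, 0;
     1, 0, 0, 0, 0, 0, 0, -1, 0, 0, 0, -1, -1, 0, 0, 1;
     0, 0, 0, 0, -1, 0, 0, 0, 0, 0, 0, 0, 0, 0, 0, 0;
     0, -1, 1, 0, 0, 0, 0, 0, 0, 0, 0, 0, 0, 0, -1, 0;
     1, 0, 0, 0, 0, 1, 0, -1, -1, 0, 1, -1, 0, 0, 0, -1;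
     0, 0, 1, 0, 0, -1, -1, 0, 0, 0, -1, 1, 0, 0, 0, 0;
     0, 0, 0, -1, 0, 0, 0, 0, 0, 0, 0, 0, 0, 0, 0, 0;
     -1, -1, 0, 0, 0, -1, 1, 1, 1, -1, -1, 1, 0, 0, 0, 0;
     -1, 0, 0, 0, 0, -1, 0, 1, 1, 0, -1, 1, -1, 0, 0, 0;
     -1, 0, 0, 0, 0, -1, 0, 1, 1, -1, -1, 1, 0, 1, -1, 0;
     0, 1, -1, 0, 0, 0, 0, 0, 0, 0, 0, 0, 0, -1, 0, 0;
     -1, 0, 0, 0, 0, 0, 0, 1, 0, 0, -1, 0, 1, 0, 0, -1;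
     -1, -1, 0, 0, 0, -1, 0, 0, 1, 1, 0, 0, 0, 0, 0, 0;
     0, 1, 0, 0, 0, 0, 0, 0, -1, -1, 1, -1, 0, 0, 0, 0;
     1, 0, 0, 0, 0, 1, -1, -1, -1, 0, 1, -1, 0, -1, 1, 0;
     0, 0, -1, 0, 0, 1, 1, -1, -1, 0, 0, 0, 0, 0, 0, 0]

/-- The inverse of `intertwiner` modulo two. -/
def intertwinerInvModTwo : Matrix (Fin 16) (Fin 16) (ZMod 2) :=
  !![1, 0, 0, 1, 0, 1, 0, 0, 0, 1, 1, 0, 1, 1, 0, 0;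
     0, 1, 0, 0, 0, 1, 0, 1, 0, 1, 0, 1, 1, 1, 1, 1;
     1, 1, 0, 0, 0, 1, 0, 0, 0, 1, 0, 1, 1, 1, 1, 1;
     0, 0, 0, 0, 0, 0, 1, 0, 0, 0, 0, 0, 0, 0, 0, 0;
     0, 0, 1, 0, 0, 0, 0, 0, 0, 0, 0, 0, 0, 0, 0, 0;
     1, 1, 0, 1, 0, 1, 0, 0, 0, 1, 1, 1, 0, 0, 0, 0;
     0, 1, 0, 1, 0, 1, 0, 0, 0, 0, 1, 1, 1, 1, 1, 1;
     0, 0, 0, 1, 0, 1, 0, 1, 0, 0, 1, 0, 0, 1, 1, 1;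
     0, 1, 0, 1, 0, 0, 0, 1, 0, 0, 1, 1, 0, 1, 1, 0;
     0, 1, 0, 1, 0, 1, 0, 0, 0, 1, 1, 1, 1, 1, 0, 1;
     1, 0, 0, 0, 1, 0, 0, 1, 1, 1, 0, 1, 1, 0, 1, 1;
     1, 1, 0, 0, 1, 0, 0, 1, 1, 1, 0, 0, 1, 0, 1, 1;
     0, 1, 0, 0, 0, 1, 0, 0, 1, 0, 0, 1, 1, 1, 0, 1;
     1, 0, 0, 0, 0, 0, 0, 1, 0, 0, 1, 0, 0, 0, 0, 0;
     1, 0, 0, 1, 0, 0, 0, 1, 0, 0, 0, 0, 0, 0, 0, 0;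
     0, 1, 0, 0, 1, 1, 0, 0, 0, 0, 0, 1, 1, 1, 0, 1]

theorem adjMatrix_mul_intertwiner :
    (ofColoredEdges classOneEdges).adjMatrix ℤ * intertwiner =
      intertwiner * (ofColoredEdges classTwoEdges).adjMatrix ℤ := by
  decide +kernel

theorem intertwiner_det_ne_zero : intertwiner.det ≠ 0 :=
  det_ne_zero_of_map_mul_eq_one (Int.castRingHom (ZMod 2)) (Q := intertwinerInvModTwo)
    (by decide +kernel)

theorem charpoly_adjMat_classOne_eq_classTwo :
    (adjMat (ofColoredEdges classOneEdges)).charpoly =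
      (adjMat (ofColoredEdges classTwoEdges)).charpoly := by
  rw [adjMat_eq_map, adjMat_eq_map]
  refine charpoly_eq_of_mul_eq_mul (P := intertwiner.map (Int.castRingHom ℝ)) ?_ ?_
  · rw [isUnit_iff_isUnit_det, ← RingHom.mapMatrix_apply, ← RingHom.map_det, isUnit_iff_ne_zero]
    simpa using intertwiner_det_ne_zero
  · rw [← Matrix.map_mul, ← Matrix.map_mul, adjMatrix_mul_intertwiner]

theorem ncard_neighborSet_eq {V : Type*} (G : SimpleGraph V) (v : V)
    [Fintype (G.neighborSet v)] : (G.neighborSet v).ncard = G.degree v :=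
  Set.ncard_eq_toFinset_card' _

theorem lineGraph_ofColoredEdges_colorable {V : Type*} [DecidableEq V] {k : ℕ} [NeZero k]
    {l : List ((V × V) × Fin k)}
    (symm : ∀ a b, listedColor l a b = listedColor l b a)
    (proper : ∀ v a, (ofColoredEdges l).Adj v a → ∀ b, (ofColoredEdges l).Adj v b → a ≠ b →
      listedColor l v a ≠ listedColor l v b) :
    (ofColoredEdges l).lineGraph.Colorable k :=
  lineGraph_colorable_iff.2
    ⟨Sym2.lift ⟨listedColor l, symm⟩, fun v a b ha hb hab => proper v a ha b hb hab⟩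

theorem chromaticIndex_classOne : chromaticIndex (ofColoredEdges classOneEdges) = 3 :=
  chromaticNumber_eq_iff_colorable_not_colorable.2
    ⟨lineGraph_ofColoredEdges_colorable (by decide +kernel) (by decide +kernel),
      not_lineGraph_colorable (l := classOneEdges.map Prod.fst) (by decide +kernel)
        (by decide +kernel)⟩

theorem chromaticIndex_classTwo : chromaticIndex (ofColoredEdges classTwoEdges) = 4 :=
  chromaticNumber_eq_iff_colorable_not_colorable.2
    ⟨lineGraph_ofColoredEdges_colorable (by decide +kernel) (by decide +kernel),
      not_lineGraph_colorable (l := classTwoEdges.map Prod.fst) (by decide +kernel)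
        (by decide +kernel)⟩

/-- There exist two cospectral, non-isomorphic cubic graphs on 16 vertices with
chromatic indexes 3 and 4 respectively. -/
theorem exists_cospectral_cubic_graphs_different_chromatic_index :
    ∃ G H : SimpleGraph (Fin 16),
      (∀ v, (G.neighborSet v).ncard = 3) ∧
      (∀ v, (H.neighborSet v).ncard = 3) ∧
      (adjMat G).charpoly = (adjMat H).charpoly ∧
      ¬ Nonempty (G ≃g H) ∧
      chromaticIndex G = 3 ∧
      chromaticIndex H = 4 := by
  refine ⟨ofColoredEdges classOneEdges, ofColoredEdges classTwoEdges, fun v => ?_, fun v => ?_,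
    charpoly_adjMat_classOne_eq_classTwo, ?_, chromaticIndex_classOne, chromaticIndex_classTwo⟩
  · rw [ncard_neighborSet_eq]
    revert v
    decide +kernel
  · rw [ncard_neighborSet_eq]
    revert v
    decide +kernel
  · rintro ⟨f⟩
    have h := chromaticIndex_congr f
    rw [chromaticIndex_classOne, chromaticIndex_classTwo] at h
    exact absurd h (by decide)
end
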